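/- Let n ≥ 3 be odd, let p₁,…,p_{n−1} be odd integers and p_n ≠ 0 an even integer, and let M be the symmetrized Seifert linking matrix of the pretzel knot P(p₁,…,p_n) as defined in the context, regarded as a real symmetric matrix. Then the signature of M (the number of positive eigenvalues minus the number of negative eigenvalues, counted with multiplicity) equals −Σ_{i=1}^{n−1} sign(p_i)·(|p_i|−1) − sign((p₁⋯p_{n−1}) · σ_{n−2}(p₁,…,p_{n−1})) + sign(σ_{n−2}(p₁,…,p_{n−1}) · σ_{n−1}(p₁,…,p_n)), where sign(0) = 0. (This is the signature of the pretzel knot P(p₁,…,p_n).) -/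

import Mathlib

open Matrix

/-- `esym p a b j` is the `j`-th elementary symmetric polynomial of the values
`p a, p (a+1), …, p (b-1)`; in the 1-indexed notation of the paper, where `p i`
denotes `p_{i+1}`, this is `σ_j(p_{a+1},…,p_b)`. -/
def esym (p : ℕ → ℤ) (a b j : ℕ) : ℤ :=
  ∑ s ∈ (Finset.Ico a b).powersetCard j, ∏ i ∈ s, p i

/-- `sgn p i = s_{i+1} = -sign(p_{i+1})` in the 1-indexed notation of the paper. -/
def sgn (p : ℕ → ℤ) (i : ℕ) : ℤ := -(p i).sign

/-- Index type for the symmetrized Seifert linking matrix of the pretzel knot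
`P(p₁,…,pₙ)` with `n` odd: pairs `(i,k)` with `1 ≤ i ≤ n−1`, `1 ≤ k ≤ |p_i|−1`
(0-indexed here), together with the two extra indices `γ = Sum.inr 0` and
`δ = Sum.inr 1`.  Its cardinality is `N = ρ₁+⋯+ρ_{n−1}+2` where `ρ_i = |p_i|−1`. -/
abbrev PIdx (n : ℕ) (p : ℕ → ℤ) : Type :=
  (Σ i : Fin (n - 1), Fin ((p i).natAbs - 1)) ⊕ Fin 2

/-- Entries of the symmetrized Seifert linking matrix `M` of `P(p₁,…,pₙ)` (`n` odd):
`M[(i,k),(i,k)] = 2s_i`, `M[(i,k),(i,l)] = s_i` for `k ≠ l`, `M[(i,k),(j,l)] = 0` for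
`i ≠ j`, `M[(i,k),γ] = M[γ,(i,k)] = s_i`, `M[(i,k),δ] = M[δ,(i,k)] = 0`,
`M[γ,γ] = s₁+⋯+s_{n−1}`, `M[γ,δ] = M[δ,γ] = 1`, `M[δ,δ] = p_n`. -/
def linkMf (n : ℕ) (p : ℕ → ℤ) : PIdx n p → PIdx n p → ℤ
  | Sum.inl ⟨i, k⟩, Sum.inl ⟨j, l⟩ =>
      if (i : ℕ) = (j : ℕ) then (if (k : ℕ) = (l : ℕ) then 2 * sgn p i else sgn p i) else 0
  | Sum.inl ⟨i, _⟩, Sum.inr g => if g = 0 then sgn p i else 0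
  | Sum.inr g, Sum.inl ⟨i, _⟩ => if g = 0 then sgn p i else 0
  | Sum.inr g, Sum.inr g' =>
      if g = 0 then (if g' = 0 then ∑ i ∈ Finset.range (n - 1), sgn p i else 1)
      else (if g' = 0 then 1 else p (n - 1))

/-- The symmetrized Seifert linking matrix of the pretzel knot `P(p₁,…,pₙ)`, `n` odd. -/
def linkM (n : ℕ) (p : ℕ → ℤ) : Matrix (PIdx n p) (PIdx n p) ℤ :=
  Matrix.of (linkMf n p)

open QuadraticMap in
/-- **Sylvester's law of inertia** for Hermitian matrices: the signature of a real symmetric matrix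
can be read off from any diagonalization of its quadratic form. -/
theorem signature_eq_sum_sign_of_diagonalization {ι : Type*} [Fintype ι] [DecidableEq ι]
    {A : Matrix ι ι ℝ} (hA : A.IsHermitian) (L : (ι → ℝ) →ₗ[ℝ] (ι → ℝ))
    (hL : Function.Injective L) (w : ι → ℝ)
    (hw : ∀ v, v ⬝ᵥ A *ᵥ v = ∑ j, w j * L v j ^ 2) :
    ((Finset.univ.filter fun z => 0 < hA.eigenvalues z).card : ℤ) -
        ((Finset.univ.filter fun z => hA.eigenvalues z < 0).card : ℤ) =
      ∑ j, (SignType.sign (w j) : ℤ) := by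
  have hsum : ∀ u : ι → ℝ, ∑ j, (SignType.sign (u j) : ℤ) =
      ((Finset.univ.filter fun z => 0 < u z).card : ℤ) -
        ((Finset.univ.filter fun z => u z < 0).card : ℤ) := by
    intro u
    rw [Finset.card_filter, Finset.card_filter]
    push_cast
    rw [← Finset.sum_sub_distrib]
    refine Finset.sum_congr rfl fun j _ => ?_
    rcases lt_trichotomy (u j) 0 with h | h | h
    · simp [h, h.not_gt]
    · simp [h]
    · simp [h, h.not_gt]
  have e₁ : (weightedSumSquares ℝ hA.eigenvalues).Equivalent A.toQuadraticForm' := by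
    let U := Unitary.toUnits hA.eigenvectorUnitary
    let e : (ι → ℝ) ≃ₗ[ℝ] (ι → ℝ) :=
      LinearEquiv.ofInjectiveEndo (Matrix.mulVecLin (hA.eigenvectorUnitary : Matrix ι ι ℝ))
        (Matrix.mulVec_injective_of_isUnit U.isUnit)
    refine ⟨⟨e, fun v => ?_⟩⟩
    have key := hA.conjStarAlgAut_star_eigenvectorUnitary
    rw [Unitary.conjStarAlgAut_star_apply] at key
    have hev : e v = (hA.eigenvectorUnitary : Matrix ι ι ℝ) *ᵥ v := rfl
    have hq : A.toQuadraticForm' (e v) = e v ⬝ᵥ A *ᵥ e v := by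
      simp [Matrix.toQuadraticForm', Matrix.toLinearMap₂'_apply']
    change A.toQuadraticForm' (e v) = _
    rw [hq, hev]
    have h2 : ((hA.eigenvectorUnitary : Matrix ι ι ℝ) *ᵥ v) =
        v ᵥ* (star (hA.eigenvectorUnitary : Matrix ι ι ℝ)) := by
      rw [Matrix.star_eq_conjTranspose, Matrix.conjTranspose_eq_transpose_of_trivial,
        Matrix.vecMul_transpose]
    conv_lhs => lhs; rw [h2]
    rw [← Matrix.dotProduct_mulVec, Matrix.mulVec_mulVec, Matrix.mulVec_mulVec,
      key]
    simp only [weightedSumSquares_apply, dotProduct, Matrix.mulVec_diagonal, smul_eq_mul,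
      Function.comp_apply, RCLike.ofReal_real_eq_id, id_eq]
    refine Finset.sum_congr rfl fun j _ => ?_
    ring
  have e₂ : A.toQuadraticForm'.Equivalent (weightedSumSquares ℝ w) := by
    refine ⟨⟨LinearEquiv.ofInjectiveEndo L hL, fun v => ?_⟩⟩
    have hq : A.toQuadraticForm' v = v ⬝ᵥ A *ᵥ v := by
      simp [Matrix.toQuadraticForm', Matrix.toLinearMap₂'_apply']
    rw [hq, hw]
    simp [weightedSumSquares_apply, pow_two]
  have hpos := (e₁.trans e₂).sigPos_eq
  have hneg := (e₁.trans e₂).sigNeg_eq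
  rw [QuadraticForm.sigPos_weightedSumSquares, QuadraticForm.sigPos_weightedSumSquares] at hpos
  rw [QuadraticForm.sigNeg_weightedSumSquares, QuadraticForm.sigNeg_weightedSumSquares] at hneg
  simp only [Set.ncard_eq_toFinset_card', Set.toFinset_ofPred] at hpos hneg
  rw [hsum, hpos, hneg]

/-- A binary form `a g² + 2 g d + q d²` with `q ≠ 0` can be diagonalized, with explicit signature. -/
theorem exists_diagonalization_binary (a q : ℝ) (hq : q ≠ 0) :
    ∃ w₀ w₁ x y : ℝ, x * y ≠ 1 ∧
      (∀ g d : ℝ, a * g ^ 2 + 2 * g * d + q * d ^ 2 =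
        w₀ * (g + x * d) ^ 2 + w₁ * (y * g + d) ^ 2) ∧
      (SignType.sign w₀ : ℤ) + SignType.sign w₁ =
        SignType.sign a + SignType.sign (a * (a * q - 1)) := by
  by_cases ha : a = 0
  · subst ha
    refine ⟨-q⁻¹, q, 0, q⁻¹, by simp, fun g d => by field_simp; ring, ?_⟩
    rcases hq.lt_or_gt with h | h
    · simp [h, inv_lt_zero.2 h]
    · simp [h, inv_pos.2 h]
  · refine ⟨a, q - a⁻¹, a⁻¹, 0, by simp, fun g d => by field_simp; ring, ?_⟩
    have h : a * (a * q - 1) = a ^ 2 * (q - a⁻¹) := by field_simp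
    rw [h, sign_mul, sign_pos (by positivity : 0 < a ^ 2), one_mul]

/-- Completing the square in `|x|² + (∑ x + g)²`, followed by the square root of `1 + J`. -/
theorem sum_sq_add_sq_sum_add {κ : Type*} [Fintype κ] (x : κ → ℝ) (g : ℝ) {r : ℝ}
    (hr : 0 < r) (hκ : (Fintype.card κ : ℝ) = r ^ 2 - 1) :
    ∑ k, (x k + (∑ l, x l) / (1 + r) + g / r) ^ 2 + g ^ 2 / r ^ 2 =
      ∑ k, x k ^ 2 + (∑ k, x k + g) ^ 2 := by
  set S := ∑ l, x l with hS
  have h : ∑ k, (x k + S / (1 + r) + g / r) ^ 2 =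
      ∑ k, x k ^ 2 + 2 * (S / (1 + r) + g / r) * S +
        (r ^ 2 - 1) * (S / (1 + r) + g / r) ^ 2 := by
    rw [← hκ, hS, Finset.mul_sum, ← nsmul_eq_mul, ← Finset.card_univ, ← Finset.sum_const,
      ← Finset.sum_add_distrib, ← Finset.sum_add_distrib]
    exact Finset.sum_congr rfl fun k _ => by ring
  rw [h]
  have : 1 + r ≠ 0 := by positivity
  field_simp
  ring

theorem esym_succ_succ (p : ℕ → ℤ) (k : ℕ) :
    esym p 0 (k + 2) (k + 1) =
      p (k + 1) * esym p 0 (k + 1) k + ∏ j ∈ Finset.range (k + 1), p j := by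
  unfold esym
  simp only [Nat.Ico_zero_eq_range]
  rw [Finset.range_add_one (n := k + 1), Finset.powersetCard_succ_insert (by simp),
    Finset.sum_union, Finset.sum_image, add_comm, Finset.mul_sum]
  · congr 1
    · refine Finset.sum_congr rfl fun s hs => ?_
      rw [Finset.prod_insert]
      intro h
      simpa using (Finset.mem_powersetCard.1 hs).1 h
    · conv_lhs => rw [show k.succ = (Finset.range (k + 1)).card by simp,
        Finset.powersetCard_self, Finset.sum_singleton]
  · intro s hs t ht hst
    have hs' : k + 1 ∉ s := fun h => by simpa using (Finset.mem_powersetCard.1 hs).1 h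
    have ht' : k + 1 ∉ t := fun h => by simpa using (Finset.mem_powersetCard.1 ht).1 h
    rw [← Finset.erase_insert hs', hst, Finset.erase_insert ht']
  · rw [Finset.disjoint_left]
    intro s hs hs'
    obtain ⟨t, -, rfl⟩ := Finset.mem_image.1 hs'
    simpa using (Finset.mem_powersetCard.1 hs).1 (Finset.mem_insert_self _ _)

/-- `σ_k(p₀,…,p_k) = p₀⋯p_k · ∑ 1/p_j` for nonzero `p_j`. -/
theorem esym_eq_prod_mul_sum_inv (p : ℕ → ℤ) (k : ℕ) (hp : ∀ i < k + 1, p i ≠ 0) :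
    (esym p 0 (k + 1) k : ℝ) =
      (∏ j ∈ Finset.range (k + 1), (p j : ℝ)) * ∑ j ∈ Finset.range (k + 1), (p j : ℝ)⁻¹ := by
  induction k with
  | zero =>
    have : (p 0 : ℝ) ≠ 0 := by exact_mod_cast hp 0 (by simp)
    simp [esym, this]
  | succ k ih =>
    have : (p (k + 1) : ℝ) ≠ 0 := by exact_mod_cast hp (k + 1) (by simp)
    rw [esym_succ_succ, Finset.prod_range_succ _ (k + 1), Finset.sum_range_succ _ (k + 1)]
    push_cast
    rw [ih fun i hi => hp i (by omega)]
    set T := ∏ j ∈ Finset.range (k + 1), (p j : ℝ)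
    rw [mul_add, mul_inv_cancel_right₀ this]
    ring

/-- The quadratic form of the symmetrized Seifert linking matrix. -/
theorem linkM_quadraticForm (n : ℕ) (p : ℕ → ℤ) (v : PIdx n p → ℝ) :
    v ⬝ᵥ ((linkM n p).map (fun x : ℤ => (x : ℝ))) *ᵥ v =
      ∑ i : Fin (n - 1), (sgn p i : ℝ) *
        (∑ k, v (Sum.inl ⟨i, k⟩) ^ 2 + (∑ k, v (Sum.inl ⟨i, k⟩) + v (Sum.inr 0)) ^ 2) +
      2 * v (Sum.inr 0) * v (Sum.inr 1) + p (n - 1) * v (Sum.inr 1) ^ 2 := by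
  have hrow : ∀ (i : Fin (n - 1)) (k : Fin ((p i).natAbs - 1)),
      (((linkM n p).map (fun x : ℤ => (x : ℝ))) *ᵥ v) (Sum.inl ⟨i, k⟩) =
        sgn p i * (v (Sum.inl ⟨i, k⟩) + ∑ l, v (Sum.inl ⟨i, l⟩) + v (Sum.inr 0)) := by
    intro i k
    have hblock : ∀ l : Fin ((p i).natAbs - 1),
        (linkMf n p (Sum.inl ⟨i, k⟩) (Sum.inl ⟨i, l⟩) : ℝ) * v (Sum.inl ⟨i, l⟩) =
          sgn p i * ((if l = k then v (Sum.inl ⟨i, l⟩) else 0) + v (Sum.inl ⟨i, l⟩)) := by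
      intro l
      by_cases h : l = k
      · subst h
        simp [linkMf]
        ring
      · have h' : (k : ℕ) ≠ l := fun hh => h (Fin.ext hh.symm)
        simp [linkMf, h, h']
    simp only [Matrix.mulVec, dotProduct, Fintype.sum_sum_type, Fintype.sum_sigma, linkM,
      Matrix.map_apply, Matrix.of_apply, Fin.sum_univ_two]
    rw [Finset.sum_eq_single i]
    · simp only [hblock]
      rw [← Finset.mul_sum, Finset.sum_add_distrib, Finset.sum_ite_eq' Finset.univ k]
      simp [linkMf]
      ring
    · intro j _ hj
      have hj' : (i : ℕ) ≠ j := fun h => hj (Fin.ext h.symm)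
      simp [linkMf, hj']
    · simp
  have hγ : (((linkM n p).map (fun x : ℤ => (x : ℝ))) *ᵥ v) (Sum.inr 0) =
      ∑ i : Fin (n - 1), (sgn p i : ℝ) * (∑ k, v (Sum.inl ⟨i, k⟩) + v (Sum.inr 0)) +
        v (Sum.inr 1) := by
    simp only [mul_add, Finset.sum_add_distrib, ← Finset.sum_mul]
    simp [Matrix.mulVec, dotProduct, Fintype.sum_sigma, linkM, linkMf, Finset.mul_sum,
      Finset.sum_range, add_assoc]
  have hδ : (((linkM n p).map (fun x : ℤ => (x : ℝ))) *ᵥ v) (Sum.inr 1) =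
      v (Sum.inr 0) + p (n - 1) * v (Sum.inr 1) := by
    simp [Matrix.mulVec, dotProduct, linkM, linkMf]
  rw [dotProduct, Fintype.sum_sum_type, Fintype.sum_sigma, Fin.sum_univ_two, hγ, hδ, mul_add,
    Finset.mul_sum, ← add_assoc, ← add_assoc, ← Finset.sum_add_distrib]
  simp only [hrow]
  have hterm : ∀ i : Fin (n - 1),
      ∑ k, v (Sum.inl ⟨i, k⟩) *
          (sgn p i * (v (Sum.inl ⟨i, k⟩) + ∑ l, v (Sum.inl ⟨i, l⟩) + v (Sum.inr 0))) +
        v (Sum.inr 0) * (sgn p i * (∑ k, v (Sum.inl ⟨i, k⟩) + v (Sum.inr 0))) =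
      sgn p i *
        (∑ k, v (Sum.inl ⟨i, k⟩) ^ 2 + (∑ k, v (Sum.inl ⟨i, k⟩) + v (Sum.inr 0)) ^ 2) := by
    intro i
    set S := ∑ l, v (Sum.inl ⟨i, l⟩) with hS
    have : ∑ k, v (Sum.inl ⟨i, k⟩) * (sgn p i * (v (Sum.inl ⟨i, k⟩) + S + v (Sum.inr 0))) =
        sgn p i * (∑ k, v (Sum.inl ⟨i, k⟩) ^ 2 + S * (S + v (Sum.inr 0))) := by
      conv_rhs => rw [hS, Finset.sum_mul, ← Finset.sum_add_distrib, Finset.mul_sum, ← hS]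
      exact Finset.sum_congr rfl fun k _ => by ring
    rw [this]
    ring
  simp only [hterm]
  ring

/-- The change of coordinates diagonalizing the symmetrized Seifert linking matrix, with
parameters `x`, `y` for the two extra coordinates. -/
noncomputable def linkMDiagonalizer (n : ℕ) (p : ℕ → ℤ) (x y : ℝ) :
    (PIdx n p → ℝ) →ₗ[ℝ] (PIdx n p → ℝ) where
  toFun v := Sum.elim
    (fun z => v (Sum.inl z) +
      (∑ l, v (Sum.inl ⟨z.1, l⟩)) / (1 + √((p z.1).natAbs : ℝ)) +
      v (Sum.inr 0) / √((p z.1).natAbs : ℝ))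
    ![v (Sum.inr 0) + x * v (Sum.inr 1), y * v (Sum.inr 0) + v (Sum.inr 1)]
  map_add' u v := by
    ext z
    rcases z with z | z
    · simp [Finset.sum_add_distrib]
      ring
    · fin_cases z <;> simp <;> ring
  map_smul' c v := by
    ext z
    rcases z with z | z
    · simp [← Finset.mul_sum]
      ring
    · fin_cases z <;> simp <;> ring

theorem sum_sq_linkMDiagonalizer_inl (n : ℕ) (p : ℕ → ℤ) (x y : ℝ) (v : PIdx n p → ℝ)
    (i : Fin (n - 1)) (hp : p i ≠ 0) :
    ∑ k, linkMDiagonalizer n p x y v (Sum.inl ⟨i, k⟩) ^ 2 +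
        v (Sum.inr 0) ^ 2 / ((p i).natAbs : ℝ) =
      ∑ k, v (Sum.inl ⟨i, k⟩) ^ 2 + (∑ k, v (Sum.inl ⟨i, k⟩) + v (Sum.inr 0)) ^ 2 := by
  have hpos : 0 < (p i).natAbs := Int.natAbs_pos.2 hp
  have hsq : √((p i).natAbs : ℝ) ^ 2 = (p i).natAbs := Real.sq_sqrt (by positivity)
  rw [← sum_sq_add_sq_sum_add (fun k => v (Sum.inl ⟨i, k⟩)) (v (Sum.inr 0))
    (r := √((p i).natAbs : ℝ)) (by positivity), hsq]
  · rfl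
  · rw [hsq, Fintype.card_fin, Nat.cast_sub hpos, Nat.cast_one]

theorem linkMDiagonalizer_injective (n : ℕ) (p : ℕ → ℤ) (hp : ∀ i < n - 1, p i ≠ 0) {x y : ℝ}
    (hxy : x * y ≠ 1) : Function.Injective (linkMDiagonalizer n p x y) := by
  rw [← LinearMap.ker_eq_bot, LinearMap.ker_eq_bot']
  intro v hv
  have h₀ : v (Sum.inr 0) + x * v (Sum.inr 1) = 0 := congrFun hv (Sum.inr 0)
  have h₁ : y * v (Sum.inr 0) + v (Sum.inr 1) = 0 := congrFun hv (Sum.inr 1)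
  have hγ : v (Sum.inr 0) = 0 := by
    have : (1 - x * y) * v (Sum.inr 0) = 0 := by linear_combination h₀ - x * h₁
    exact (mul_eq_zero.1 this).resolve_left (sub_ne_zero.2 hxy.symm)
  have hδ : v (Sum.inr 1) = 0 := by simpa [hγ] using h₁
  ext z
  rcases z with ⟨i, k⟩ | z
  · have h := sum_sq_linkMDiagonalizer_inl n p x y v i (hp i i.2)
    rw [hv, hγ] at h
    simp only [Pi.zero_apply, ne_eq, OfNat.ofNat_ne_zero, not_false_eq_true, zero_pow,
      Finset.sum_const_zero, zero_div, add_zero] at h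
    have hle := Finset.single_le_sum (f := fun k => v (Sum.inl ⟨i, k⟩) ^ 2)
      (fun k _ => sq_nonneg _) (Finset.mem_univ k)
    have : v (Sum.inl ⟨i, k⟩) ^ 2 ≤ 0 := by
      have := sq_nonneg (∑ k, v (Sum.inl ⟨i, k⟩))
      linarith
    simpa using le_antisymm this (sq_nonneg _)
  · fin_cases z
    · exact hγ
    · exact hδ

theorem sgn_div_natAbs (p : ℕ → ℤ) (i : ℕ) :
    (sgn p i : ℝ) / ((p i).natAbs : ℝ) = -(p i : ℝ)⁻¹ := by
  rw [sgn, Nat.cast_natAbs]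
  rcases lt_trichotomy (p i) 0 with h | h | h
  · simp [Int.sign_eq_neg_one_of_neg h, abs_of_neg h, inv_neg]
  · simp [h]
  · simp [Int.sign_eq_one_of_pos h, abs_of_pos h, neg_div]

/-- The signature of the symmetrized Seifert linking matrix of `P(p₁,…,pₙ)` (`n` odd),
i.e. the number of positive eigenvalues minus the number of negative eigenvalues of
`M` as a real symmetric matrix, equals
`−Σ_{i=1}^{n−1} sign(p_i)·(|p_i|−1) − sign((p₁⋯p_{n−1})·σ_{n−2}(p₁,…,p_{n−1}))
  + sign(σ_{n−2}(p₁,…,p_{n−1})·σ_{n−1}(p₁,…,pₙ))`. -/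
theorem stmt13 (n : ℕ) (hn : 3 ≤ n) (hodd : Odd n) (p : ℕ → ℤ)
    (hpodd : ∀ i, i < n - 1 → Odd (p i)) (hpeven : Even (p (n - 1)))
    (hpne : p (n - 1) ≠ 0)
    (hM : ((linkM n p).map (fun x : ℤ => (x : ℝ))).IsHermitian) :
    ((Finset.univ.filter fun z => 0 < hM.eigenvalues z).card : ℤ) -
        ((Finset.univ.filter fun z => hM.eigenvalues z < 0).card : ℤ) =
      -(∑ i ∈ Finset.range (n - 1), (p i).sign * (((p i).natAbs : ℤ) - 1)) -
        ((∏ j ∈ Finset.range (n - 1), p j) * esym p 0 (n - 1) (n - 2)).sign +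
        (esym p 0 (n - 1) (n - 2) * esym p 0 n (n - 1)).sign := by
  have hp : ∀ i < n - 1, p i ≠ 0 := fun i hi h => by simpa [h] using hpodd i hi
  obtain ⟨m, rfl⟩ : ∃ m, n = m + 2 := ⟨n - 2, by omega⟩
  simp only [Nat.add_sub_cancel, show m + 2 - 1 = m + 1 by omega] at hp hpne ⊢
  set P : ℝ := ∏ j ∈ Finset.range (m + 1), (p j : ℝ) with hP
  set a : ℝ := -∑ j ∈ Finset.range (m + 1), (p j : ℝ)⁻¹ with ha
  have hP0 : P ≠ 0 := Finset.prod_ne_zero_iff.2 fun j hj => by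
    exact_mod_cast hp j (Finset.mem_range.1 hj)
  have hσ : (esym p 0 (m + 1) m : ℝ) = -(P * a) := by
    rw [esym_eq_prod_mul_sum_inv p m hp, ha, hP]
    ring
  obtain ⟨w₀, w₁, x, y, hxy, hdiag, hsign⟩ :=
    exists_diagonalization_binary a (p (m + 1)) (by exact_mod_cast hpne)
  rw [signature_eq_sum_sign_of_diagonalization hM (linkMDiagonalizer (m + 2) p x y)
    (linkMDiagonalizer_injective (m + 2) p hp hxy)
    (Sum.elim (fun z => (sgn p z.1 : ℝ)) ![w₀, w₁])]
  · simp only [Fintype.sum_sum_type, Fintype.sum_sigma, Fin.sum_univ_two, Sum.elim_inl,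
      Sum.elim_inr, Matrix.cons_val_zero, Matrix.cons_val_one, hsign]
    have hblocks : ∑ i : Fin (m + 2 - 1), ∑ _k : Fin ((p i).natAbs - 1),
        (SignType.sign (sgn p i : ℝ) : ℤ) =
          -∑ i ∈ Finset.range (m + 1), (p i).sign * (((p i).natAbs : ℤ) - 1) := by
      rw [← Finset.sum_neg_distrib, Finset.sum_range]
      refine Finset.sum_congr rfl fun i _ => ?_
      have hpos : 1 ≤ (p i).natAbs := Int.natAbs_pos.2 (hp i i.2)
      rw [Finset.sum_const, Finset.card_univ, Fintype.card_fin, nsmul_eq_mul,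
        Nat.cast_sub hpos, sign_intCast, ← Int.sign_eq_sign, sgn, Int.sign_neg, Int.sign_sign]
      push_cast
      ring
    have hsa : (SignType.sign a : ℤ) =
        -((∏ j ∈ Finset.range (m + 1), p j) * esym p 0 (m + 1) m).sign := by
      have h : (((∏ j ∈ Finset.range (m + 1), p j) * esym p 0 (m + 1) m : ℤ) : ℝ) =
          P ^ 2 * -a := by
        push_cast
        rw [hσ, ← hP]
        ring
      rw [Int.sign_eq_sign, ← sign_intCast (α := ℝ), h, sign_mul,
        sign_pos (by positivity : 0 < P ^ 2), one_mul, Left.sign_neg, SignType.coe_neg, neg_neg]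
    have hsb : (SignType.sign (a * (a * p (m + 1) - 1)) : ℤ) =
        (esym p 0 (m + 1) m * esym p 0 (m + 2) (m + 1)).sign := by
      have h : ((esym p 0 (m + 1) m * esym p 0 (m + 2) (m + 1) : ℤ) : ℝ) =
          P ^ 2 * (a * (a * p (m + 1) - 1)) := by
        rw [esym_succ_succ]
        push_cast
        rw [hσ, ← hP]
        ring
      rw [Int.sign_eq_sign, ← sign_intCast (α := ℝ), h, sign_mul _ (a * _),
        sign_pos (by positivity : 0 < P ^ 2), one_mul]
    rw [hblocks, hsa, hsb]
    ring
  · intro v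
    rw [linkM_quadraticForm, Fintype.sum_sum_type, Fintype.sum_sigma, Fin.sum_univ_two]
    simp only [Sum.elim_inl, Sum.elim_inr, Matrix.cons_val_zero, Matrix.cons_val_one,
      ← Finset.mul_sum]
    have h2 := hdiag (v (Sum.inr 0)) (v (Sum.inr 1))
    have hblock : ∀ i : Fin (m + 2 - 1), (sgn p i : ℝ) *
        (∑ k, v (Sum.inl ⟨i, k⟩) ^ 2 + (∑ k, v (Sum.inl ⟨i, k⟩) + v (Sum.inr 0)) ^ 2) =
        sgn p i * ∑ k, linkMDiagonalizer (m + 2) p x y v (Sum.inl ⟨i, k⟩) ^ 2 +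
          -(p i : ℝ)⁻¹ * v (Sum.inr 0) ^ 2 := by
      intro i
      rw [← sum_sq_linkMDiagonalizer_inl (m + 2) p x y v i (hp i i.2), ← sgn_div_natAbs]
      ring
    simp only [hblock]
    rw [Finset.sum_add_distrib, ← Finset.sum_mul, Finset.sum_neg_distrib,
      ← Finset.sum_range (fun i => (p i : ℝ)⁻¹)]
    change _ = _ + (w₀ * (v (Sum.inr 0) + x * v (Sum.inr 1)) ^ 2 +
      w₁ * (y * v (Sum.inr 0) + v (Sum.inr 1)) ^ 2)
    rw [← h2, ha]
    simp only [show m + 2 - 1 = m + 1 by omega]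
    ring
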